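/- Suppose the DFP initialization satisfies ‖x_0 − x_*‖ ≤ (μ^{3/2}/(M√L))·ε and ‖B̂_0 − I‖_F ≤ δ, where ε, δ > 0 are such that for some r ∈ (0, 1) both [4(2δ + 1)/(1 − ε)² + (3 + ε)/(1 − ε)]·ε/(1 − r) ≤ δ and ε + 2δ ≤ r/(1 + r). Then for every k ≥ 1 the DFP iterates satisfy ‖x_k − x_*‖ ≤ √(L/μ)·( (2√2·δ·((1 + r)/(1 − ε))·√k + (1 + r)ε/((1 − r)(1 − ε))) / k )^k · ‖x_0 − x_*‖. -/

import Mathlib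

noncomputable section

open Matrix Finset

abbrev E (d : ℕ) := EuclideanSpace ℝ (Fin d)
abbrev Mat (d : ℕ) := Matrix (Fin d) (Fin d) ℝ

/-- Spectral (operator 2-) norm of a real matrix. -/
def spec {d : ℕ} (A : Mat d) : ℝ := ‖Matrix.toEuclideanCLM (𝕜 := ℝ) A‖

/-- Frobenius norm of a real matrix. -/
def frob {d : ℕ} (A : Mat d) : ℝ := Real.sqrt (∑ i, ∑ j, (A i j) ^ 2)

/-- A matrix acting on a Euclidean vector. -/
def mApp {d : ℕ} (A : Mat d) (v : E d) : E d := Matrix.toEuclideanCLM (𝕜 := ℝ) A v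

/-- Outer product `u vᵀ`. -/
def outer {d : ℕ} (u v : E d) : Mat d := Matrix.of fun i j => u i * v j

/-- Euclidean dot product. -/
def dot {d : ℕ} (u v : E d) : ℝ := ∑ i, u i * v i

/-- `σ(x) = (M/μ^{3/2})·‖H_*^{1/2}(x − x_*)‖`. -/
def sig {d : ℕ} (M μ : ℝ) (sqH : Mat d) (xs x : E d) : ℝ :=
  M / μ ^ ((3:ℝ)/2) * ‖mApp sqH (x - xs)‖

/-- The DFP update of the Hessian approximation. -/
def dfpUpdate {d : ℕ} (B : Mat d) (s y : E d) : Mat d :=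
  (1 - (dot y s)⁻¹ • outer y s) * B * (1 - (dot s y)⁻¹ • outer s y)
    + (dot y s)⁻¹ • outer y y

section MatrixLemmas

variable {d : ℕ}

lemma mApp_apply (A : Mat d) (v : E d) (i : Fin d) : mApp A v i = ∑ j, A i j * v j := by
  rw [mApp, Matrix.ofLp_toEuclideanCLM]; rfl

lemma mApp_mul (A C : Mat d) (v : E d) : mApp (A * C) v = mApp A (mApp C v) := by
  simp [mApp, map_mul]

lemma mApp_one (v : E d) : mApp 1 v = v := by simp [mApp]

lemma mApp_sub_left (A C : Mat d) (v : E d) : mApp (A - C) v = mApp A v - mApp C v := by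
  simp [mApp, map_sub]

lemma mApp_sub (A : Mat d) (u v : E d) : mApp A (u - v) = mApp A u - mApp A v := by
  simp [mApp, map_sub]

lemma mApp_zero (A : Mat d) : mApp A 0 = 0 := by simp [mApp]

lemma dot_eq_inner (u v : E d) : dot u v = inner ℝ u v := by
  simp [dot, PiLp.inner_apply, mul_comm]

lemma dot_comm (u v : E d) : dot u v = dot v u := by
  simp [dot, mul_comm]

lemma dot_self (u : E d) : dot u u = ‖u‖ ^ 2 := by
  rw [dot_eq_inner, real_inner_self_eq_norm_sq]

lemma dot_mApp (A : Mat d) (u v : E d) : dot u (mApp A v) = dot (mApp Aᵀ u) v := by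
  simp only [dot, mApp_apply, Finset.mul_sum, Finset.sum_mul, Matrix.transpose_apply]
  rw [Finset.sum_comm]
  exact Finset.sum_congr rfl fun i _ => Finset.sum_congr rfl fun j _ => by ring

lemma outer_transpose (u v : E d) : (outer u v)ᵀ = outer v u := by
  ext i j; simp [outer, mul_comm]

lemma mul_outer (A : Mat d) (u v : E d) : A * outer u v = outer (mApp A u) v := by
  ext i j
  simp only [outer, Matrix.mul_apply, Matrix.of_apply, mApp_apply, Finset.sum_mul]
  exact Finset.sum_congr rfl fun k _ => by ring

lemma outer_mul (A : Mat d) (u v : E d) : outer u v * A = outer u (mApp Aᵀ v) := by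
  ext i j
  simp only [outer, Matrix.mul_apply, Matrix.of_apply, mApp_apply, Finset.mul_sum,
    Matrix.transpose_apply]
  exact Finset.sum_congr rfl fun k _ => by ring

lemma mApp_outer (u v a : E d) : mApp (outer u v) a = dot v a • u := by
  ext i
  simp only [outer, mApp_apply, dot, Matrix.of_apply, PiLp.smul_apply, smul_eq_mul,
    Finset.sum_mul]
  exact Finset.sum_congr rfl fun k _ => by ring

lemma frob_sq (A : Mat d) : frob A ^ 2 = ∑ i, ∑ j, A i j ^ 2 :=
  Real.sq_sqrt (Finset.sum_nonneg fun _ _ => Finset.sum_nonneg fun _ _ => sq_nonneg _)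

lemma frob_nonneg (A : Mat d) : 0 ≤ frob A := Real.sqrt_nonneg _

lemma frob_eq_norm (A : Mat d) :
    frob A = ‖(WithLp.toLp 2 fun p : Fin d × Fin d => A p.1 p.2)‖ := by
  simp [frob, EuclideanSpace.norm_eq, Fintype.sum_prod_type]

lemma frob_add_le (A C : Mat d) : frob (A + C) ≤ frob A + frob C := by
  simp only [frob_eq_norm]
  exact norm_add_le (WithLp.toLp 2 fun p : Fin d × Fin d => A p.1 p.2)
    (WithLp.toLp 2 fun p : Fin d × Fin d => C p.1 p.2)

lemma frob_transpose (A : Mat d) : frob Aᵀ = frob A := by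
  simp only [frob, Matrix.transpose_apply]
  rw [Finset.sum_comm]

lemma frob_outer (u v : E d) : frob (outer u v) = ‖u‖ * ‖v‖ := by
  rw [← sq_eq_sq₀ (frob_nonneg _) (by positivity), frob_sq, mul_pow, ← dot_self, ← dot_self]
  simp only [outer, Matrix.of_apply, dot, Finset.sum_mul_sum]
  exact Finset.sum_congr rfl fun i _ => Finset.sum_congr rfl fun j _ => by ring

lemma frob_sq_eq_sum_rows (A : Mat d) :
    frob A ^ 2 = ∑ i, ‖(WithLp.toLp 2 (A i) : E d)‖ ^ 2 := by
  simp [frob_sq, EuclideanSpace.real_norm_sq_eq]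

lemma mApp_apply_eq_dot (A : Mat d) (v : E d) (i : Fin d) :
    mApp A v i = dot (WithLp.toLp 2 (A i)) v := by
  simp [mApp_apply, dot]

lemma norm_mApp_le_frob (A : Mat d) (v : E d) : ‖mApp A v‖ ≤ frob A * ‖v‖ := by
  refine le_of_sq_le_sq ?_ (mul_nonneg (frob_nonneg _) (norm_nonneg _))
  rw [EuclideanSpace.real_norm_sq_eq, mul_pow, frob_sq_eq_sum_rows, Finset.sum_mul]
  refine Finset.sum_le_sum fun i _ => ?_
  rw [mApp_apply_eq_dot, dot_eq_inner, ← mul_pow, sq_le_sq,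
    abs_of_nonneg (a := ‖_‖ * ‖_‖) (by positivity)]
  exact abs_real_inner_le_norm _ _

lemma norm_mApp_le (A : Mat d) (v : E d) : ‖mApp A v‖ ≤ (frob (A - 1) + 1) * ‖v‖ := by
  have h : mApp A v = v + mApp (A - 1) v := by rw [mApp_sub_left, mApp_one]; abel
  rw [h, add_mul, one_mul, add_comm (_ * _)]
  exact (norm_add_le _ _).trans (by gcongr; exact norm_mApp_le_frob _ _)

/-- The orthogonal projection onto the complement of `s`. -/
def perpProj (s : E d) : Mat d := 1 - (dot s s)⁻¹ • outer s s

lemma perpProj_transpose (s : E d) : (perpProj s)ᵀ = perpProj s := by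
  simp [perpProj, outer_transpose]

lemma mApp_perpProj (s a : E d) : mApp (perpProj s) a = a - ((dot s s)⁻¹ * dot s a) • s := by
  rw [perpProj, mApp_sub_left, mApp_one]
  congr 1
  rw [← smul_smul, ← mApp_outer]
  simp [mApp]

lemma norm_mApp_perpProj_sq {s : E d} (hs : s ≠ 0) (a : E d) :
    ‖mApp (perpProj s) a‖ ^ 2 = ‖a‖ ^ 2 - dot a s ^ 2 / ‖s‖ ^ 2 := by
  have hs' : ‖s‖ ≠ 0 := norm_ne_zero_iff.2 hs
  rw [mApp_perpProj, dot_self, norm_sub_sq_real, real_inner_smul_right, ← dot_eq_inner,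
    dot_comm s a, norm_smul, mul_pow, Real.norm_eq_abs, sq_abs]
  field_simp
  ring

lemma norm_mApp_perpProj_le {s : E d} (hs : s ≠ 0) (a : E d) :
    ‖mApp (perpProj s) a‖ ≤ ‖a‖ := by
  refine le_of_sq_le_sq ?_ (norm_nonneg _)
  rw [norm_mApp_perpProj_sq hs]
  exact sub_le_self _ (by positivity)

lemma perpProj_mul_self {s : E d} (hs : s ≠ 0) : perpProj s * perpProj s = perpProj s := by
  have hs' : dot s s ≠ 0 := by rw [dot_self]; simpa using hs
  have h : outer s s * outer s s = dot s s • outer s s := by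
    rw [mul_outer, mApp_outer]
    ext i j; simp [outer, mul_assoc]
  simp only [perpProj, mul_sub, sub_mul, mul_one, one_mul, Matrix.smul_mul, Matrix.mul_smul, h,
    smul_smul]
  rw [inv_mul_cancel₀ hs', mul_one]
  abel

lemma frob_mul_perpProj_sq (C : Mat d) {s : E d} (hs : s ≠ 0) :
    frob (C * perpProj s) ^ 2 = frob C ^ 2 - ‖mApp C s‖ ^ 2 / ‖s‖ ^ 2 := by
  have hrow : ∀ i, (WithLp.toLp 2 ((C * perpProj s) i) : E d)
      = mApp (perpProj s) (WithLp.toLp 2 (C i)) := fun i => by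
    ext j
    nth_rw 2 [← perpProj_transpose]
    simp [mApp_apply, Matrix.mul_apply, mul_comm]
  rw [frob_sq_eq_sum_rows, frob_sq_eq_sum_rows, EuclideanSpace.real_norm_sq_eq, Finset.sum_div,
    ← Finset.sum_sub_distrib]
  exact Finset.sum_congr rfl fun i _ => by
    rw [hrow, norm_mApp_perpProj_sq hs, mApp_apply_eq_dot]

lemma frob_perpProj_mul_le (C : Mat d) {s : E d} (hs : s ≠ 0) :
    frob (perpProj s * C) ≤ frob C := by
  rw [← frob_transpose, Matrix.transpose_mul, perpProj_transpose, ← frob_transpose C]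
  refine le_of_sq_le_sq ?_ (frob_nonneg _)
  rw [frob_mul_perpProj_sq _ hs]
  exact sub_le_self _ (by positivity)

lemma frob_perpProj_mul_perpProj_le {C : Mat d} {s : E d} {D : ℝ} (hs : s ≠ 0) (hD : 0 < D)
    (hC : frob C ≤ D) :
    frob (perpProj s * C * perpProj s) ≤ frob C - (‖mApp C s‖ / ‖s‖) ^ 2 / (2 * D) := by
  have hs' : 0 < ‖s‖ := norm_pos_iff.2 hs
  set q := (‖mApp C s‖ / ‖s‖) ^ 2 with hq
  have hq0 : 0 ≤ q := by positivity
  have hqC : q ≤ frob C ^ 2 := by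
    rw [hq]
    gcongr
    rw [div_le_iff₀ hs']
    exact norm_mApp_le_frob _ _
  have hN := frob_nonneg C
  have hle : frob (perpProj s * C * perpProj s) ^ 2 ≤ frob C ^ 2 - q := by
    rw [mul_assoc, hq, div_pow, ← frob_mul_perpProj_sq C hs]
    gcongr
    · exact frob_nonneg _
    · exact frob_perpProj_mul_le _ hs
  obtain ⟨t, ht⟩ : ∃ t, t = q / (2 * D) := ⟨_, rfl⟩
  have hqt : q = 2 * D * t := by rw [ht]; field_simp
  have ht0 : 0 ≤ t := by rw [ht]; positivity
  rw [← ht]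
  refine le_of_sq_le_sq (hle.trans ?_) ?_
  · rw [hqt]
    nlinarith [mul_nonneg ht0 (sub_nonneg.2 hC)]
  · have : 2 * D * t ≤ D * frob C := by
      rw [← hqt]; nlinarith
    nlinarith [le_of_mul_le_mul_left (by linarith : D * (2 * t) ≤ D * frob C) hD]

lemma dfpUpdate_sub_one_eq (A : Mat d) {s : E d} (y : E d) (hs : s ≠ 0) :
    dfpUpdate A s y - 1 = perpProj s * (A - 1) * perpProj s
      + outer ((dot s s)⁻¹ • s - (dot y s)⁻¹ • y)
          (mApp (1 - (dot y s)⁻¹ • outer y s) (mApp Aᵀ s))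
      + outer (mApp (perpProj s) (mApp A s)) ((dot s s)⁻¹ • s - (dot y s)⁻¹ • y)
      + outer (y - s) ((dot s s)⁻¹ • s)
      + outer (-y) ((dot s s)⁻¹ • s - (dot y s)⁻¹ • y) := by
  set w := (dot s s)⁻¹ • s - (dot y s)⁻¹ • y with hw
  have hQ : (1 : Mat d) - (dot y s)⁻¹ • outer s y = perpProj s + outer s w := by
    rw [perpProj, hw]; ext i j; simp [outer]; ring
  have hQt : (1 : Mat d) - (dot y s)⁻¹ • outer y s = perpProj s + outer w s := by
    rw [perpProj, hw]; ext i j; simp [outer]; ring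
  have hQQ : (1 - (dot y s)⁻¹ • outer y s : Mat d) = (1 - (dot y s)⁻¹ • outer s y)ᵀ := by
    simp [outer_transpose]
  have e1 : outer w (mApp (1 - (dot y s)⁻¹ • outer y s) (mApp Aᵀ s))
      = outer w s * A * (1 - (dot y s)⁻¹ • outer s y) := by
    rw [hQQ, outer_mul, outer_mul]
  have e2 : outer (mApp (perpProj s) (mApp A s)) w = perpProj s * A * outer s w := by
    rw [mul_outer, mApp_mul]
  have e3 : outer (y - s) ((dot s s)⁻¹ • s) + outer (-y) w
      = (dot y s)⁻¹ • outer y y - (dot s s)⁻¹ • outer s s := by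
    rw [hw]; ext i j; simp [outer]; ring
  have e4 : (1 : Mat d) = perpProj s * perpProj s + (dot s s)⁻¹ • outer s s := by
    rw [perpProj_mul_self hs, perpProj]; abel
  rw [add_assoc (_ + _ + _), e3, e1, e2, dfpUpdate, dot_comm s y, hQt, hQ]
  nth_rw 1 [e4]
  noncomm_ring

/-- Bounded deterioration of the DFP update: if `y` is close to `s`, the distance of the Hessian
approximation to the identity decreases up to an error proportional to `‖y - s‖ / ‖s‖`. -/
lemma frob_dfpUpdate_sub_one_le {A : Mat d} {s y : E d} {D ε τ : ℝ} (hs : s ≠ 0) (hD : 0 < D)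
    (hA : frob (A - 1) ≤ D) (hε : ε < 1) (hτ : τ ≤ ε) (hy : ‖y - s‖ ≤ τ * ‖s‖) :
    frob (dfpUpdate A s y - 1) ≤ frob (A - 1) - (‖mApp (A - 1) s‖ / ‖s‖) ^ 2 / (2 * D)
      + (4 * (D + 1) / (1 - ε) ^ 2 + (3 + ε) / (1 - ε)) * τ := by
  have hs' : 0 < ‖s‖ := norm_pos_iff.2 hs
  have hτ0 : 0 ≤ τ := nonneg_of_mul_nonneg_left ((norm_nonneg _).trans hy) hs'
  have h1ε : 0 < 1 - ε := sub_pos.2 hε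
  have hρ : (1 - ε) * ‖s‖ ^ 2 ≤ dot y s := by
    have h1 : dot y s = ‖s‖ ^ 2 + inner ℝ (y - s) s := by
      rw [dot_eq_inner, inner_sub_left, real_inner_self_eq_norm_sq]; ring
    have h2 : |inner ℝ (y - s) s| ≤ τ * ‖s‖ * ‖s‖ :=
      (abs_real_inner_le_norm _ _).trans (by gcongr)
    have h3 : τ * ‖s‖ * ‖s‖ ≤ ε * ‖s‖ * ‖s‖ := by gcongr
    rw [h1]
    linarith [neg_abs_le (inner ℝ (y - s) s)]
  have hρ0 : 0 < dot y s := lt_of_lt_of_le (by positivity) hρ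
  set w := (dot s s)⁻¹ • s - (dot y s)⁻¹ • y with hw
  have hwn : ‖w‖ * ‖s‖ ≤ τ / (1 - ε) := by
    have h1 : w = (-(dot y s)⁻¹) • mApp (perpProj s) (y - s) := by
      rw [mApp_perpProj, hw]
      have : dot s (y - s) = dot y s - dot s s := by
        simp only [dot_eq_inner, inner_sub_right, real_inner_comm]
      have hss : dot s s ≠ 0 := by rw [dot_self]; positivity
      rw [this, mul_sub, inv_mul_cancel₀ hss]
      simp only [smul_sub, sub_smul, smul_smul]
      have : -(dot y s)⁻¹ * ((dot s s)⁻¹ * dot y s) = -(dot s s)⁻¹ := by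
        field_simp
      rw [this]
      module
    have h2 : ‖w‖ ≤ (dot y s)⁻¹ * (τ * ‖s‖) := by
      rw [h1, norm_smul, norm_neg, norm_inv, Real.norm_of_nonneg hρ0.le]
      gcongr
      exact (norm_mApp_perpProj_le hs _).trans hy
    calc ‖w‖ * ‖s‖ ≤ (dot y s)⁻¹ * (τ * ‖s‖) * ‖s‖ := by gcongr
      _ = τ * ‖s‖ ^ 2 / dot y s := by rw [div_eq_inv_mul]; ring
      _ ≤ τ * ‖s‖ ^ 2 / ((1 - ε) * ‖s‖ ^ 2) := by gcongr
      _ = τ / (1 - ε) := by field_simp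
  have hQ (z : E d) : ‖mApp (1 - (dot y s)⁻¹ • outer y s) z‖ ≤ 1 / (1 - ε) * ‖z‖ := by
    have h1 : (1 : Mat d) - (dot y s)⁻¹ • outer y s = perpProj s - outer (-w) s := by
      rw [perpProj, hw]; ext i j; simp [outer]; ring
    rw [h1, mApp_sub_left]
    calc _ ≤ ‖z‖ + frob (outer (-w) s) * ‖z‖ := (norm_sub_le _ _).trans
          (add_le_add (norm_mApp_perpProj_le hs z) (norm_mApp_le_frob _ _))
      _ ≤ ‖z‖ + ε / (1 - ε) * ‖z‖ := by
          rw [frob_outer, norm_neg]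
          gcongr
          exact hwn.trans (by gcongr)
      _ = 1 / (1 - ε) * ‖z‖ := by field_simp; ring
  have hAt : frob (Aᵀ - 1) ≤ D := by
    rw [← frob_transpose]; simpa using hA
  have hAts : ‖mApp Aᵀ s‖ ≤ (D + 1) * ‖s‖ :=
    (norm_mApp_le _ _).trans (by gcongr)
  have hAs : ‖mApp A s‖ ≤ (D + 1) * ‖s‖ :=
    (norm_mApp_le _ _).trans (by gcongr)
  have hyn : ‖y‖ ≤ (1 + ε) * ‖s‖ := by
    have : ‖y‖ ≤ ‖y - s‖ + ‖s‖ := by simpa using norm_add_le (y - s) s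
    have h3 : τ * ‖s‖ ≤ ε * ‖s‖ := by gcongr
    linarith
  have t1 : frob (outer w (mApp (1 - (dot y s)⁻¹ • outer y s) (mApp Aᵀ s)))
      ≤ (D + 1) / (1 - ε) ^ 2 * τ := by
    rw [frob_outer]
    calc _ ≤ ‖w‖ * (1 / (1 - ε) * ((D + 1) * ‖s‖)) := by
          gcongr
          exact (hQ _).trans (by gcongr)
      _ = (‖w‖ * ‖s‖) * ((D + 1) / (1 - ε)) := by ring
      _ ≤ τ / (1 - ε) * ((D + 1) / (1 - ε)) := by gcongr
      _ = _ := by field_simp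
  have t2 : frob (outer (mApp (perpProj s) (mApp A s)) w) ≤ (D + 1) / (1 - ε) * τ := by
    rw [frob_outer]
    calc _ ≤ (D + 1) * ‖s‖ * ‖w‖ := by
          gcongr
          exact (norm_mApp_perpProj_le hs _).trans hAs
      _ = (‖w‖ * ‖s‖) * (D + 1) := by ring
      _ ≤ τ / (1 - ε) * (D + 1) := by gcongr
      _ = _ := by ring
  have t3 : frob (outer (y - s) ((dot s s)⁻¹ • s)) ≤ τ := by
    rw [frob_outer, norm_smul, norm_inv, dot_self, Real.norm_of_nonneg (by positivity)]
    calc _ ≤ τ * ‖s‖ * ((‖s‖ ^ 2)⁻¹ * ‖s‖) := by gcongr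
      _ = τ := by field_simp
  have t4 : frob (outer (-y) w) ≤ (1 + ε) / (1 - ε) * τ := by
    rw [frob_outer, norm_neg]
    calc _ ≤ (1 + ε) * ‖s‖ * ‖w‖ := by gcongr
      _ = (‖w‖ * ‖s‖) * (1 + ε) := by ring
      _ ≤ τ / (1 - ε) * (1 + ε) := by gcongr; linarith
      _ = _ := by ring
  have hsum : (D + 1) / (1 - ε) ^ 2 + (D + 1) / (1 - ε) + 1 + (1 + ε) / (1 - ε)
      ≤ 4 * (D + 1) / (1 - ε) ^ 2 + (3 + ε) / (1 - ε) := by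
    have h1 : (D + 1) / (1 - ε) ≤ (D + 1) / (1 - ε) ^ 2 := by
      gcongr
      nlinarith
    have h2 : 0 ≤ (D + 1) / (1 - ε) ^ 2 := by positivity
    have h3 : 1 + (1 + ε) / (1 - ε) = 2 / (1 - ε) := by field_simp; ring
    have h4 : 2 / (1 - ε) ≤ (3 + ε) / (1 - ε) := by gcongr; linarith
    have h5 : 4 * (D + 1) / (1 - ε) ^ 2 = 4 * ((D + 1) / (1 - ε) ^ 2) := by ring
    linarith
  have hτsum := mul_le_mul_of_nonneg_right hsum hτ0
  have hP := frob_perpProj_mul_perpProj_le hs hD hA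
  rw [dfpUpdate_sub_one_eq A y hs]
  refine (frob_add_le _ _).trans ?_
  have a3 := frob_add_le (perpProj s * (A - 1) * perpProj s
      + outer w (mApp (1 - (dot y s)⁻¹ • outer y s) (mApp Aᵀ s))
      + outer (mApp (perpProj s) (mApp A s)) w) (outer (y - s) ((dot s s)⁻¹ • s))
  have a2 := frob_add_le (perpProj s * (A - 1) * perpProj s
      + outer w (mApp (1 - (dot y s)⁻¹ • outer y s) (mApp Aᵀ s)))
      (outer (mApp (perpProj s) (mApp A s)) w)
  have a1 := frob_add_le (perpProj s * (A - 1) * perpProj s)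
      (outer w (mApp (1 - (dot y s)⁻¹ • outer y s) (mApp Aᵀ s)))
  linarith

end MatrixLemmas

lemma prod_range_le_div_pow_of_sum_le {k : ℕ} (hk : 1 ≤ k) {z : ℕ → ℝ} (hz : ∀ i, 0 ≤ z i) {C : ℝ}
    (hC : ∑ i ∈ range k, z i ≤ C) : ∏ i ∈ range k, z i ≤ (C / k) ^ k := by
  have hk0 : (0 : ℝ) < k := by exact_mod_cast hk
  have h := Real.geom_mean_le_arith_mean (range k) (fun _ => 1) z (fun _ _ => zero_le_one)
    (by simpa using hk0) (fun i _ => hz i)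
  simp only [Real.rpow_one, Finset.sum_const, Finset.card_range, nsmul_eq_mul, mul_one,
    one_mul] at h
  have hp : 0 ≤ ∏ i ∈ range k, z i := Finset.prod_nonneg fun i _ => hz i
  calc ∏ i ∈ range k, z i = ((∏ i ∈ range k, z i) ^ ((k : ℝ)⁻¹)) ^ k :=
        (Real.rpow_inv_natCast_pow hp (by omega)).symm
    _ ≤ (C / k) ^ k := by
        gcongr
        exact h.trans (by gcongr)

lemma sum_geometric_range_le {r : ℝ} (hr0 : 0 ≤ r) (hr1 : r < 1) (k : ℕ) :
    ∑ i ∈ range k, r ^ i ≤ 1 / (1 - r) := by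
  rw [geom_sum_eq hr1.ne, ← neg_div_neg_eq, neg_sub, neg_sub]
  have := sub_pos.2 hr1
  gcongr
  linarith [pow_nonneg hr0 k]

section NormalizedIteration

variable {d : ℕ}

lemma mApp_inv_mApp {A : Mat d} (hA : IsUnit A.det) (v : E d) : mApp A⁻¹ (mApp A v) = v := by
  rw [← mApp_mul, Matrix.nonsing_inv_mul _ hA, mApp_one]

lemma mApp_mApp_inv {A : Mat d} (hA : IsUnit A.det) (v : E d) : mApp A (mApp A⁻¹ v) = v := by
  rw [← mApp_mul, Matrix.mul_nonsing_inv _ hA, mApp_one]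

lemma mul_norm_le_norm_mApp {A : Mat d} {D : ℝ} (hA : frob (A - 1) ≤ D) (v : E d) :
    (1 - D) * ‖v‖ ≤ ‖mApp A v‖ := by
  have h : v = mApp A v - mApp (A - 1) v := by rw [mApp_sub_left, mApp_one]; abel
  have h1 := norm_sub_le (mApp A v) (mApp (A - 1) v)
  rw [← h] at h1
  have h2 : ‖mApp (A - 1) v‖ ≤ D * ‖v‖ := (norm_mApp_le_frob _ _).trans (by gcongr)
  linarith

lemma isUnit_det_of_frob_sub_one_lt {A : Mat d} (hA : frob (A - 1) < 1) : IsUnit A.det := by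
  rw [isUnit_iff_ne_zero]
  intro h0
  obtain ⟨v, hv, hAv⟩ := Matrix.exists_mulVec_eq_zero_iff.2 h0
  have h1 := mul_norm_le_norm_mApp le_rfl (A := A) (WithLp.toLp 2 v)
  have h2 : mApp A (WithLp.toLp 2 v) = 0 := by
    ext i; simpa [mApp_apply, Matrix.mulVec, dotProduct] using congrFun hAv i
  have h3 : 0 < ‖(WithLp.toLp 2 v : E d)‖ := norm_pos_iff.2 (by simpa using hv)
  rw [h2, norm_zero] at h1
  nlinarith

/-- Superlinear convergence of DFP in coordinates where the Hessian at the minimizer is the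
identity: `e k` is the error, `G k` the gradient and `A k` the Hessian approximation. -/
lemma dfp_superlinear_of_normalized {e G : ℕ → E d} {A : ℕ → Mat d} {c ε δ r : ℝ}
    (hc : 0 < c) (hδ : 0 < δ) (hr0 : 0 < r) (hr1 : r < 1) (hε : 0 < ε)
    (hc1 : (4 * (2 * δ + 1) / (1 - ε) ^ 2 + (3 + ε) / (1 - ε)) * (ε / (1 - r)) ≤ δ)
    (hc2 : ε + 2 * δ ≤ r / (1 + r))
    (hG : ∀ k, ‖G k - e k‖ ≤ c * ‖e k‖ * ‖e k‖)
    (hy : ∀ k, ‖(G (k + 1) - G k) - (e (k + 1) - e k)‖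
      ≤ c * max ‖e k‖ ‖e (k + 1)‖ * ‖e (k + 1) - e k‖)
    (hs : ∀ k, e (k + 1) - e k ≠ 0)
    (hstep : ∀ k, e (k + 1) = e k - mApp (A k)⁻¹ (G k))
    (hAup : ∀ k, A (k + 1) = dfpUpdate (A k) (e (k + 1) - e k) (G (k + 1) - G k))
    (he0 : c * ‖e 0‖ ≤ ε) (hA0 : frob (A 0 - 1) ≤ δ) {k : ℕ} (hk : 1 ≤ k) :
    ‖e k‖ ≤ ((2 * Real.sqrt 2 * δ * ((1 + r) / (1 - ε)) * Real.sqrt k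
      + (1 + r) * ε / ((1 - r) * (1 - ε))) / k) ^ k * ‖e 0‖ := by
  have hrr : r / (1 + r) < 1 / 2 := by rw [div_lt_div_iff₀] <;> linarith
  have hε1 : ε < 1 := by linarith
  have h1ε : 0 < 1 - ε := sub_pos.2 hε1
  have h1r : 0 < 1 - r := sub_pos.2 hr1
  set W := 4 * (2 * δ + 1) / (1 - ε) ^ 2 + (3 + ε) / (1 - ε) with hW
  have hW0 : 0 ≤ W := by positivity
  set q : ℕ → ℝ := fun i => ‖mApp (A i - 1) (e (i + 1) - e i)‖ / ‖e (i + 1) - e i‖ with hq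
  have hq0 (i : ℕ) : 0 ≤ q i := by positivity
  have hsumσ {k : ℕ} (h : ∀ i, i ≤ k → ‖e i‖ ≤ r ^ i * ‖e 0‖) :
      ∑ i ∈ range (k + 1), c * ‖e i‖ ≤ ε / (1 - r) := by
    calc _ ≤ ∑ i ∈ range (k + 1), r ^ i * ε := by
          refine Finset.sum_le_sum fun i hi => ?_
          calc c * ‖e i‖ ≤ c * (r ^ i * ‖e 0‖) := by
                gcongr; exact h i (by simpa [Nat.lt_succ_iff] using hi)
            _ = r ^ i * (c * ‖e 0‖) := by ring
            _ ≤ r ^ i * ε := by gcongr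
      _ ≤ 1 / (1 - r) * ε := by
          rw [← Finset.sum_mul]
          gcongr
          exact sum_geometric_range_le hr0.le hr1 _
      _ = ε / (1 - r) := by ring
  have hσ {i : ℕ} (h : ‖e i‖ ≤ r ^ i * ‖e 0‖) : c * ‖e i‖ ≤ ε := by
    refine le_trans ?_ he0
    gcongr
    exact h.trans (mul_le_of_le_one_left (norm_nonneg _) (pow_le_one₀ hr0.le hr1.le))
  have hlin {i : ℕ} (h : ‖e i‖ ≤ r ^ i * ‖e 0‖) (hA : frob (A i - 1) ≤ 2 * δ) :
      ‖e (i + 1)‖ ≤ r * ‖e i‖ := by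
    have hu : IsUnit (A i).det := isUnit_det_of_frob_sub_one_lt (by linarith)
    have h1 : mApp (A i) (e (i + 1)) = mApp (A i - 1) (e i) - (G i - e i) := by
      rw [hstep, mApp_sub, mApp_mApp_inv hu, mApp_sub_left, mApp_one]; abel
    have h2 := mul_norm_le_norm_mApp hA (e (i + 1))
    have h3 : ‖mApp (A i) (e (i + 1))‖ ≤ 2 * δ * ‖e i‖ + ε * ‖e i‖ := by
      rw [h1]
      refine (norm_sub_le _ _).trans (add_le_add ?_ ?_)
      · exact (norm_mApp_le_frob _ _).trans (by gcongr)
      · exact (hG i).trans (by gcongr; exact hσ h)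
    have h4 : (ε + 2 * δ) * (1 + r) ≤ r := (le_div_iff₀ (by linarith)).1 hc2
    have h5 : ε + 2 * δ ≤ r * (1 - 2 * δ) := by nlinarith
    have h6 : (1 - 2 * δ) * ‖e (i + 1)‖ ≤ (1 - 2 * δ) * (r * ‖e i‖) := by
      have := mul_le_mul_of_nonneg_right h5 (norm_nonneg (e i))
      linarith
    exact le_of_mul_le_mul_left h6 (by linarith)
  have main (k : ℕ) : (∀ i, i ≤ k → ‖e i‖ ≤ r ^ i * ‖e 0‖ ∧ frob (A i - 1) ≤ 2 * δ) ∧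
      frob (A k - 1) + (∑ i ∈ range k, q i ^ 2) / (2 * (2 * δ))
        ≤ δ + W * ∑ i ∈ range k, c * ‖e i‖ := by
    induction k with
    | zero =>
      refine ⟨fun i hi => ?_, by simpa using hA0⟩
      obtain rfl : i = 0 := by omega
      exact ⟨by simp, by linarith⟩
    | succ k ih =>
      obtain ⟨ih1, ih2⟩ := ih
      obtain ⟨hek, hAk⟩ := ih1 k le_rfl
      have hle := hlin hek hAk
      have hmax : max ‖e k‖ ‖e (k + 1)‖ = ‖e k‖ :=
        max_eq_left (hle.trans (mul_le_of_le_one_left (norm_nonneg _) hr1.le))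
      have hyk := hy k
      rw [hmax] at hyk
      have hdet := frob_dfpUpdate_sub_one_le (hs k) (by linarith : 0 < 2 * δ) hAk hε1 (hσ hek) hyk
      rw [← hAup, ← hW] at hdet
      have hnew : frob (A (k + 1) - 1) + (∑ i ∈ range (k + 1), q i ^ 2) / (2 * (2 * δ))
          ≤ δ + W * ∑ i ∈ range (k + 1), c * ‖e i‖ := by
        rw [Finset.sum_range_succ, Finset.sum_range_succ, add_div, mul_add]
        linarith
      refine ⟨fun i hi => ?_, hnew⟩
      rcases Nat.lt_or_ge k i with hki | hki
      · obtain rfl : i = k + 1 := by omega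
        refine ⟨hle.trans ?_, ?_⟩
        · calc r * ‖e k‖ ≤ r * (r ^ k * ‖e 0‖) := by gcongr
            _ = r ^ (k + 1) * ‖e 0‖ := by ring
        · have h1 := hsumσ fun i hi => (ih1 i hi).1
          have h2 := mul_le_mul_of_nonneg_left h1 hW0
          have h3 : 0 ≤ (∑ i ∈ range (k + 1), q i ^ 2) / (2 * (2 * δ)) :=
            div_nonneg (Finset.sum_nonneg fun i _ => sq_nonneg _) (by linarith)
          linarith
      · exact ih1 i hki
  have hlin' (i : ℕ) : ‖e i‖ ≤ r ^ i * ‖e 0‖ := ((main i).1 i le_rfl).1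
  have hA (i : ℕ) : frob (A i - 1) ≤ 2 * δ := ((main i).1 i le_rfl).2
  have hsum (k : ℕ) : ∑ i ∈ range k, c * ‖e i‖ ≤ ε / (1 - r) :=
    (Finset.sum_le_sum_of_subset_of_nonneg (Finset.range_mono k.le_succ)
      fun i _ _ => by positivity).trans (hsumσ fun i _ => hlin' i)
  have hqsq : ∑ i ∈ range k, q i ^ 2 ≤ 8 * δ ^ 2 := by
    have h1 := (main k).2
    have h2 := mul_le_mul_of_nonneg_left (hsum k) hW0
    have h3 : (∑ i ∈ range k, q i ^ 2) / (2 * (2 * δ)) ≤ 2 * δ := by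
      linarith [frob_nonneg (A k - 1)]
    rw [div_le_iff₀ (by linarith)] at h3
    linarith
  have hqsum : ∑ i ∈ range k, q i ≤ 2 * Real.sqrt 2 * δ * Real.sqrt k := by
    refine le_of_sq_le_sq ?_ (by positivity)
    have h1 := sq_sum_le_card_mul_sum_sq (s := range k) (f := q)
    rw [Finset.card_range] at h1
    have h2 : (2 * Real.sqrt 2 * δ * Real.sqrt k) ^ 2 = k * (8 * δ ^ 2) := by
      simp only [mul_pow]
      rw [Real.sq_sqrt (by norm_num), Real.sq_sqrt (by positivity)]
      ring
    rw [h2]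
    exact h1.trans (by gcongr)
  have hratio (i : ℕ) :
      ‖e (i + 1)‖ ≤ (1 + r) / (1 - ε) * (q i + c * ‖e i‖) * ‖e i‖ := by
    have hle := hlin (hlin' i) (hA i)
    have hmax : max ‖e i‖ ‖e (i + 1)‖ = ‖e i‖ :=
      max_eq_left (hle.trans (mul_le_of_le_one_left (norm_nonneg _) hr1.le))
    have hyi := hy i
    rw [hmax] at hyi
    have hu : IsUnit (A i).det := isUnit_det_of_frob_sub_one_lt (by linarith [hA i])
    have hs0 : 0 < ‖e (i + 1) - e i‖ := norm_pos_iff.2 (hs i)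
    have hGn : G (i + 1) = ((G (i + 1) - G i) - (e (i + 1) - e i))
        - mApp (A i - 1) (e (i + 1) - e i) := by
      have : mApp (A i) (e (i + 1) - e i) = - G i := by
        rw [hstep i, sub_sub_cancel_left, ← neg_one_smul ℝ (mApp _ _)]
        simp only [mApp, map_smul]
        rw [neg_one_smul, neg_inj]
        exact mApp_mApp_inv hu _
      rw [mApp_sub_left, mApp_one, this]
      abel
    have h1 : ‖G (i + 1)‖ ≤ (q i + c * ‖e i‖) * ‖e (i + 1) - e i‖ := by
      rw [hGn, add_comm (q i), add_mul]
      refine (norm_sub_le _ _).trans (add_le_add hyi ?_)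
      simp only [hq]
      rw [div_mul_cancel₀ _ hs0.ne']
    have h2 : (1 - ε) * ‖e (i + 1)‖ ≤ ‖G (i + 1)‖ := by
      have h3 : ‖e (i + 1)‖ ≤ ‖G (i + 1)‖ + ‖G (i + 1) - e (i + 1)‖ := by
        simpa using norm_sub_le (G (i + 1)) (G (i + 1) - e (i + 1))
      have h4 := (hG (i + 1)).trans
        (mul_le_mul_of_nonneg_right (hσ (hlin' (i + 1))) (norm_nonneg _))
      linarith
    have h3 : ‖e (i + 1) - e i‖ ≤ (1 + r) * ‖e i‖ := (norm_sub_le _ _).trans (by linarith)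
    have h4 : (1 - ε) * ‖e (i + 1)‖ ≤ (q i + c * ‖e i‖) * ((1 + r) * ‖e i‖) :=
      h2.trans (h1.trans (by gcongr))
    rw [mul_comm, ← le_div_iff₀ h1ε] at h4
    exact h4.trans_eq (by ring)
  have hprod : ‖e k‖ ≤ (∏ i ∈ range k, (1 + r) / (1 - ε) * (q i + c * ‖e i‖)) * ‖e 0‖ := by
    clear hqsum hqsq hk
    induction k with
    | zero => simp
    | succ k ih =>
      rw [Finset.prod_range_succ, mul_right_comm, mul_comm _ (_ / _ * _)]
      refine (hratio k).trans ?_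
      have : 0 ≤ (1 + r) / (1 - ε) * (q k + c * ‖e k‖) :=
        mul_nonneg (by positivity) (add_nonneg (hq0 k) (by positivity))
      gcongr
  refine hprod.trans (mul_le_mul_of_nonneg_right (prod_range_le_div_pow_of_sum_le hk
    (fun i => mul_nonneg (by positivity) (add_nonneg (hq0 i) (by positivity))) ?_) (norm_nonneg _))
  rw [← Finset.mul_sum, Finset.sum_add_distrib]
  calc _ ≤ (1 + r) / (1 - ε) * (2 * Real.sqrt 2 * δ * Real.sqrt k + ε / (1 - r)) := by
        gcongr
        exact hsum k
    _ = _ := by field_simp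

end NormalizedIteration

section Normalization

variable {d : ℕ}

lemma dfpUpdate_conj {S : Mat d} (hS : IsUnit S.det) (hSt : Sᵀ = S) (B : Mat d) (s y : E d) :
    S⁻¹ * dfpUpdate B s y * S⁻¹
      = dfpUpdate (S⁻¹ * B * S⁻¹) (mApp S s) (mApp S⁻¹ y) := by
  have hit : (S⁻¹)ᵀ = S⁻¹ := by rw [Matrix.transpose_nonsing_inv, hSt]
  have hdot : dot (mApp S⁻¹ y) (mApp S s) = dot y s := by
    rw [dot_mApp, hSt, mApp_mApp_inv hS]
  have hs : mApp (S⁻¹)ᵀ (mApp S s) = s := by rw [hit, mApp_inv_mApp hS]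
  have e1 : (1 - (dot y s)⁻¹ • outer (mApp S⁻¹ y) (mApp S s)) * S⁻¹
      = S⁻¹ * (1 - (dot y s)⁻¹ • outer y s) := by
    rw [sub_mul, mul_sub, Matrix.smul_mul, Matrix.mul_smul, mul_outer, outer_mul, hs, one_mul,
      mul_one]
  have e2 : S⁻¹ * (1 - (dot y s)⁻¹ • outer (mApp S s) (mApp S⁻¹ y))
      = (1 - (dot y s)⁻¹ • outer s y) * S⁻¹ := by
    rw [sub_mul, mul_sub, Matrix.smul_mul, Matrix.mul_smul, mul_outer, outer_mul, hit,
      mApp_inv_mApp hS, one_mul, mul_one]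
  have e3 : outer (mApp S⁻¹ y) (mApp S⁻¹ y) = S⁻¹ * outer y y * S⁻¹ := by
    rw [mul_outer, outer_mul, hit]
  rw [dfpUpdate, dfpUpdate, dot_comm (mApp S s), hdot, dot_comm s y, e3]
  calc _ = S⁻¹ * (1 - (dot y s)⁻¹ • outer y s) * B * ((1 - (dot y s)⁻¹ • outer s y) * S⁻¹)
        + (dot y s)⁻¹ • (S⁻¹ * outer y y * S⁻¹) := by
        rw [mul_add, add_mul, Matrix.mul_smul, Matrix.smul_mul]
        simp only [mul_assoc]
    _ = _ := by rw [← e1, ← e2]; simp only [mul_assoc]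

lemma norm_grad_sub_sub_le {g : E d → E d} {Hess : E d → Mat d} {xs : E d} {M : ℝ} (hM : 0 ≤ M)
    (hHd : ∀ x, HasFDerivAt g (Matrix.toEuclideanCLM (𝕜 := ℝ) (Hess x)) x)
    (hLip : ∀ x, spec (Hess x - Hess xs) ≤ M * ‖x - xs‖) (x z : E d) :
    ‖g x - g z - mApp (Hess xs) (x - z)‖ ≤ M * max ‖z - xs‖ ‖x - xs‖ * ‖x - z‖ := by
  refine (convex_closedBall xs (max ‖z - xs‖ ‖x - xs‖)).norm_image_sub_le_of_norm_hasFDerivWithin_le'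
    (fun w _ => (hHd w).hasFDerivWithinAt) (fun w hw => ?_) ?_ ?_
  · have h := hLip w
    rw [spec, map_sub] at h
    exact h.trans (by gcongr; simpa [dist_eq_norm] using hw)
  · simp [dist_eq_norm]
  · simp [dist_eq_norm]

end Normalization

theorem dfp_superlinear_convergence
    {d : ℕ}
    (f : E d → ℝ) (g : E d → E d) (Hess : E d → Mat d) (xs : E d)
    (μ L M : ℝ) (hμ : 0 < μ) (hμL : μ ≤ L) (hM : 0 < M)
    -- `g` is the gradient of `f`, and `Hess` its Hessian (so `f` is twice differentiable)
    (hg : ∀ x, HasGradientAt f (g x) x)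
    (hHd : ∀ x, HasFDerivAt g (Matrix.toEuclideanCLM (𝕜 := ℝ) (Hess x)) x)
    -- `xs` is the unique minimizer of `f`
    (hmin : ∀ x, f xs ≤ f x)
    (huniq : ∀ x, (∀ y, f x ≤ f y) → x = xs)
    -- Assumption 1: strong convexity and gradient Lipschitz continuity
    (hgl : ∀ x y, μ * ‖x - y‖ ≤ ‖g x - g y‖)
    (hgu : ∀ x y, ‖g x - g y‖ ≤ L * ‖x - y‖)
    (hHl : ∀ x v, μ * ‖v‖ ^ 2 ≤ dot v (mApp (Hess x) v))
    (hHu : ∀ x v, dot v (mApp (Hess x) v) ≤ L * ‖v‖ ^ 2)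
    -- Assumption 2: Hessian Lipschitz continuity toward the optimum
    (hLip : ∀ x, spec (Hess x - Hess xs) ≤ M * ‖x - xs‖)
    -- `sqH` is the positive definite square root `H_*^{1/2}` of `H_* = ∇²f(x_*)`
    (sqH : Mat d) (hsqH : sqH.PosDef) (hsqH2 : sqH * sqH = Hess xs)
    -- the DFP method
    (x : ℕ → E d) (B : ℕ → Mat d)
    (hB0pd : (B 0).PosDef)
    (hxup : ∀ k, x (k+1) = x k - mApp (B k)⁻¹ (g (x k)))
    (hsne : ∀ k, x (k+1) - x k ≠ 0)
    (hBup : ∀ k, B (k+1) = dfpUpdate (B k) (x (k+1) - x k) (g (x (k+1)) - g (x k)))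
    (ε δ r : ℝ) (hε : 0 < ε) (hδ : 0 < δ) (hr0 : 0 < r) (hr1 : r < 1)
    (hc1 : (4 * (2*δ + 1) / (1 - ε)^2 + (3 + ε) / (1 - ε)) * (ε / (1 - r)) ≤ δ)
    (hc2 : ε + 2*δ ≤ r / (1 + r))
    (hx0 : ‖x 0 - xs‖ ≤ μ ^ ((3:ℝ)/2) / (M * Real.sqrt L) * ε)
    (hB0 : frob (sqH⁻¹ * B 0 * sqH⁻¹ - 1) ≤ δ) :
    ∀ k : ℕ, 1 ≤ k →
      ‖x k - xs‖ ≤ Real.sqrt (L / μ) *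
        ((2 * Real.sqrt 2 * δ * ((1 + r) / (1 - ε)) * Real.sqrt (k:ℝ)
            + (1 + r) * ε / ((1 - r) * (1 - ε))) / (k:ℝ)) ^ k * ‖x 0 - xs‖ := by

  have hSu : IsUnit sqH.det := hsqH.isUnit.map Matrix.detMonoidHom
  have hSt : sqHᵀ = sqH := by
    simpa [Matrix.IsHermitian, Matrix.conjTranspose_eq_transpose_of_trivial] using hsqH.isHermitian
  have hL : 0 < L := hμ.trans_le hμL
  have hsμ : 0 < Real.sqrt μ := Real.sqrt_pos.2 hμ
  have hsL : 0 < Real.sqrt L := Real.sqrt_pos.2 hL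
  have hμ32 : μ ^ ((3 : ℝ) / 2) = Real.sqrt μ ^ 3 := by
    rw [Real.sqrt_eq_rpow, ← Real.rpow_natCast, ← Real.rpow_mul hμ.le]
    norm_num
  rw [hμ32] at hx0
  have hSsq (v : E d) : ‖mApp sqH v‖ ^ 2 = dot v (mApp (Hess xs) v) := by
    rw [← dot_self, ← hsqH2, mApp_mul, dot_mApp sqH v, hSt]
  have hSl (v : E d) : Real.sqrt μ * ‖v‖ ≤ ‖mApp sqH v‖ := by
    refine le_of_sq_le_sq ?_ (norm_nonneg _)
    rw [mul_pow, Real.sq_sqrt hμ.le, hSsq]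
    exact hHl xs v
  have hSuL (v : E d) : ‖mApp sqH v‖ ≤ Real.sqrt L * ‖v‖ := by
    refine le_of_sq_le_sq ?_ (by positivity)
    rw [mul_pow, Real.sq_sqrt hL.le, hSsq]
    exact hHu xs v
  have hgs : g xs = 0 := by
    have hloc : IsLocalMin f xs := Filter.Eventually.of_forall hmin
    have h := hloc.hasFDerivAt_eq_zero (hg xs).hasFDerivAt
    simpa using h
  have key (z w : E d) : ‖mApp sqH⁻¹ (g z - g w) - mApp sqH (z - w)‖
      ≤ M / Real.sqrt μ ^ 3 * max ‖mApp sqH (w - xs)‖ ‖mApp sqH (z - xs)‖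
        * ‖mApp sqH (z - w)‖ := by
    have h1 : mApp sqH⁻¹ (g z - g w) - mApp sqH (z - w)
        = mApp sqH⁻¹ (g z - g w - mApp (Hess xs) (z - w)) := by
      rw [mApp_sub _ (g z - g w), ← hsqH2, mApp_mul, mApp_inv_mApp hSu]
    have h2 := hSl (mApp sqH⁻¹ (g z - g w - mApp (Hess xs) (z - w)))
    rw [mApp_mApp_inv hSu] at h2
    have h3 := h2.trans (norm_grad_sub_sub_le hM.le hHd hLip z w)
    rw [h1]
    set m := max ‖w - xs‖ ‖z - xs‖
    set m' := max ‖mApp sqH (w - xs)‖ ‖mApp sqH (z - xs)‖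
    have hm : Real.sqrt μ * m ≤ m' := by
      rw [mul_max_of_nonneg _ _ hsμ.le]
      exact max_le_max (hSl _) (hSl _)
    have hm0 : 0 ≤ m' := le_max_of_le_left (norm_nonneg _)
    have h4 : Real.sqrt μ ^ 3 * ‖mApp sqH⁻¹ (g z - g w - mApp (Hess xs) (z - w))‖
        ≤ M * m' * ‖mApp sqH (z - w)‖ := by
      calc _ = Real.sqrt μ ^ 2
              * (Real.sqrt μ * ‖mApp sqH⁻¹ (g z - g w - mApp (Hess xs) (z - w))‖) := by ring
        _ ≤ Real.sqrt μ ^ 2 * (M * m * ‖z - w‖) := by gcongr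
        _ = M * (Real.sqrt μ * m) * (Real.sqrt μ * ‖z - w‖) := by ring
        _ ≤ _ := by gcongr; exact hSl _
    rw [mul_comm, ← le_div_iff₀ (by positivity)] at h4
    exact h4.trans_eq (by ring)
  intro k hk
  have hx' (i : ℕ) : mApp sqH (x (i + 1) - xs) - mApp sqH (x i - xs)
      = mApp sqH (x (i + 1) - x i) := by
    rw [← mApp_sub, sub_sub_sub_cancel_right]
  have hcore := dfp_superlinear_of_normalized (e := fun i => mApp sqH (x i - xs))
    (G := fun i => mApp sqH⁻¹ (g (x i))) (A := fun i => sqH⁻¹ * B i * sqH⁻¹)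
    (c := M / Real.sqrt μ ^ 3) (ε := ε) (δ := δ) (r := r) (by positivity) hδ hr0 hr1 hε hc1 hc2
    (fun i => by simpa [hgs, mApp_zero] using key (x i) xs)
    (fun i => by
      rw [hx', ← mApp_sub]
      exact key (x (i + 1)) (x i))
    (fun i h => by
      rw [hx'] at h
      have h1 := mApp_inv_mApp hSu (x (i + 1) - x i)
      rw [h, mApp_zero] at h1
      exact hsne i h1.symm)
    (fun i => by
      rw [Matrix.mul_inv_rev, Matrix.mul_inv_rev, Matrix.nonsing_inv_nonsing_inv _ hSu, mApp_mul,
        mApp_mul, mApp_mApp_inv hSu, ← mApp_sub, hxup i, sub_right_comm])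
    (fun i => by
      rw [hx', ← mApp_sub, ← dfpUpdate_conj hSu hSt, ← hBup])
    (by
      calc M / Real.sqrt μ ^ 3 * ‖mApp sqH (x 0 - xs)‖
          ≤ M / Real.sqrt μ ^ 3 * (Real.sqrt L * (Real.sqrt μ ^ 3 / (M * Real.sqrt L) * ε)) := by
            gcongr
            exact (hSuL _).trans (by gcongr)
        _ = ε := by field_simp)
    hB0 hk
  have hε1 : ε < 1 := by
    have : r / (1 + r) < 1 := by rw [div_lt_one] <;> linarith
    linarith
  have h1ε : 0 < 1 - ε := sub_pos.2 hε1
  have h1r : 0 < 1 - r := sub_pos.2 hr1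
  set R := ((2 * Real.sqrt 2 * δ * ((1 + r) / (1 - ε)) * Real.sqrt (k : ℝ)
    + (1 + r) * ε / ((1 - r) * (1 - ε))) / (k : ℝ)) ^ k with hR
  have hR0 : 0 ≤ R := by positivity
  have h1 : Real.sqrt μ * ‖x k - xs‖ ≤ R * (Real.sqrt L * ‖x 0 - xs‖) :=
    (hSl _).trans (hcore.trans (by gcongr; exact hSuL _))
  rw [mul_comm, ← le_div_iff₀ hsμ] at h1
  refine h1.trans_eq ?_
  rw [Real.sqrt_div hL.le]
  ring
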